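/- Assume Setup (†). For each i ∈ [r] let B_i = {u ∈ V_i : d_{V_i}(u) ≥ 1} and C_i = V_i \ B_i. Then for all sufficiently large n: (1) |B_i| ≤ 2a for every i ∈ [r]; and (2) for every i ∈ [r], every vertex u ∈ C_i is adjacent in G to all vertices of V(G) \ V_i. -/

import Mathlib

open SimpleGraph

/-- The adjacency matrix of a simple graph over `ℝ`. -/
noncomputable def adjMat {V : Type*} [Fintype V] (G : SimpleGraph V) : Matrix V V ℝ :=
  letI := Classical.decRel G.Adj
  G.adjMatrix ℝ

/-- The spectral radius of a simple graph: the largest eigenvalue of its adjacency matrix. -/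
noncomputable def specRad {V : Type*} [Fintype V] [DecidableEq V] (G : SimpleGraph V) : ℝ :=
  sSup (spectrum ℝ (adjMat G))

/-- The number of edges of a simple graph. -/
noncomputable def eCnt {V : Type*} (G : SimpleGraph V) : ℕ := Nat.card G.edgeSet

/-- `G` contains a copy of `F` (a subgraph isomorphic to `F`). -/
def Contains {W V : Type*} (F : SimpleGraph W) (G : SimpleGraph V) : Prop :=
  ∃ f : F →g G, Function.Injective f

/-- `G` is `F`-free. -/
def FFree {W V : Type*} (F : SimpleGraph W) (G : SimpleGraph V) : Prop := ¬ Contains F G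

/-- The Turán number `ex(n, F)`. -/
noncomputable def exNum {W : Type*} (n : ℕ) (F : SimpleGraph W) : ℕ :=
  sSup {m | ∃ G : SimpleGraph (Fin n), FFree F G ∧ eCnt G = m}

/-- `G` is obtained from the Turán graph `T_{n,r}` by adding `a` edges. -/
def TuranPlus (n r a : ℕ) (G : SimpleGraph (Fin n)) : Prop :=
  (∃ H : SimpleGraph (Fin n), H ≤ G ∧ Nonempty (H ≃g turanGraph n r)) ∧
    eCnt G = eCnt (turanGraph n r) + a

/-- Hypothesis (★): for all sufficiently large `m`, `ex(m,F) = e(T_{m,r}) + a` and every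
extremal graph is obtained from `T_{m,r}` by adding `a` edges. -/
def HypStar {W : Type*} (r a : ℕ) (F : SimpleGraph W) : Prop :=
  ∃ m₀ : ℕ, ∀ m ≥ m₀,
    exNum m F = eCnt (turanGraph m r) + a ∧
    ∀ G : SimpleGraph (Fin m), FFree F G → eCnt G = exNum m F → TuranPlus m r a G

/-- `G` is a spectral-extremal `F`-free graph on its vertex set. -/
def SpecExtremal {W : Type*} (F : SimpleGraph W) {n : ℕ} (G : SimpleGraph (Fin n)) : Prop :=
  FFree F G ∧ ∀ G' : SimpleGraph (Fin n), FFree F G' → specRad G' ≤ specRad G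

/-- Number of edges of `G` joining two distinct parts of the partition `p`. -/
noncomputable def crossCnt {n r : ℕ} (G : SimpleGraph (Fin n)) (p : Fin n → Fin r) : ℕ :=
  Nat.card {e : Sym2 (Fin n) // e ∈ G.edgeSet ∧ ¬ (Sym2.map p e).IsDiag}

/-- Number of edges of `G` inside part `i` of the partition `p`, i.e. `e(G[Vᵢ])`. -/
noncomputable def inCnt {n r : ℕ} (G : SimpleGraph (Fin n)) (p : Fin n → Fin r)
    (i : Fin r) : ℕ :=
  Nat.card {e : Sym2 (Fin n) // e ∈ G.edgeSet ∧ Sym2.map p e = Sym2.diag i}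

/-- The size of part `i` of the partition `p`, i.e. `|Vᵢ|`. -/
noncomputable def partSize {n r : ℕ} (p : Fin n → Fin r) (i : Fin r) : ℕ :=
  Nat.card {v : Fin n // p v = i}

/-- The degree of `v` in `G`. -/
noncomputable def deg {n : ℕ} (G : SimpleGraph (Fin n)) (v : Fin n) : ℕ :=
  Nat.card (G.neighborSet v)

/-- `d_{Vᵢ}(v)`, the number of neighbours of `v` in part `i` of the partition `p`. -/
noncomputable def degIn {n r : ℕ} (G : SimpleGraph (Fin n)) (p : Fin n → Fin r)
    (i : Fin r) (v : Fin n) : ℕ :=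
  Nat.card {w : Fin n // G.Adj v w ∧ p w = i}

/-- The partition `p` into `r` parts maximizes the number of edges between distinct parts,
`∑ eᵢ(Vᵢ) ≤ ε n²`, and each part has size strictly between `(1/r − 3√ε)n` and `(1/r + 3√ε)n`. -/
def GoodPartition (r : ℕ) {n : ℕ} (G : SimpleGraph (Fin n)) (ε : ℝ)
    (p : Fin n → Fin r) : Prop :=
  (∀ q : Fin n → Fin r, crossCnt G q ≤ crossCnt G p) ∧
  (∑ i : Fin r, (inCnt G p i : ℝ)) ≤ ε * n ^ 2 ∧
  ∀ i : Fin r, (1 / (r : ℝ) - 3 * Real.sqrt ε) * n < partSize p i ∧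
    (partSize p i : ℝ) < (1 / (r : ℝ) + 3 * Real.sqrt ε) * n

/-- The set `L` of low-degree vertices. -/
def Lset (r : ℕ) {n : ℕ} (G : SimpleGraph (Fin n)) (ε : ℝ) : Set (Fin n) :=
  {v | (deg G v : ℝ) ≤ (1 - 1 / (r : ℝ) - 3 * r * ε ^ ((1 : ℝ) / 3)) * n}

/-- The set `W` of vertices with many neighbours inside their own part. -/
def Wset {n r : ℕ} (G : SimpleGraph (Fin n)) (p : Fin n → Fin r) (θ : ℝ) : Set (Fin n) :=
  {v | 2 * θ * n ≤ (degIn G p (p v) v : ℝ)}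

open Classical in
lemma adjMat_apply {V : Type*} [Fintype V] (G : SimpleGraph V) (u v : V) :
    adjMat G u v = if G.Adj u v then 1 else 0 := by
  simp [adjMat, adjMatrix_apply]

lemma adjMat_isHermitian {V : Type*} [Fintype V] (G : SimpleGraph V) :
    (adjMat G).IsHermitian := by
  ext u v
  simp only [Matrix.conjTranspose_apply, adjMat_apply, star_trivial]
  congr 1
  exact propext (G.adj_comm v u)

open Classical in
lemma adjMat_mulVec {V : Type*} [Fintype V] (G : SimpleGraph V) (x : V → ℝ) (u : V) :
    (adjMat G).mulVec x u = ∑ v, if G.Adj u v then x v else 0 := by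
  simp [Matrix.mulVec, dotProduct, adjMat_apply]

open Classical in
lemma dotProduct_adjMat_mulVec {V : Type*} [Fintype V] (G : SimpleGraph V) (x : V → ℝ) :
    x ⬝ᵥ (adjMat G).mulVec x = ∑ u, ∑ v, if G.Adj u v then x u * x v else 0 := by
  simp [dotProduct, adjMat_mulVec, Finset.mul_sum]

lemma specRad_smul_sub_posSemidef {V : Type*} [Fintype V] [DecidableEq V]
    (G : SimpleGraph V) : (algebraMap ℝ (Matrix V V ℝ) (specRad G) - adjMat G).PosSemidef := by
  rw [Matrix.posSemidef_iff_isHermitian_and_spectrum_nonneg]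
  refine ⟨?_, ?_⟩
  · refine Matrix.IsHermitian.sub ?_ (adjMat_isHermitian G)
    rw [Matrix.IsHermitian, Algebra.algebraMap_eq_smul_one]
    simp
  · intro s hs
    rw [← spectrum.singleton_sub_eq] at hs
    obtain ⟨b, hb, rfl⟩ := by simpa using hs
    have : b ≤ specRad G := le_csSup (Matrix.finite_real_spectrum.bddAbove) hb
    simpa using this

open Classical in
/-- The Rayleigh principle for the adjacency matrix. -/
lemma sum_adj_mul_le_specRad {V : Type*} [Fintype V] [DecidableEq V]
    (G : SimpleGraph V) (x : V → ℝ) :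
    ∑ u, ∑ v, (if G.Adj u v then x u * x v else 0) ≤ specRad G * ∑ u, x u ^ 2 := by
  have h := (specRad_smul_sub_posSemidef G).dotProduct_mulVec_nonneg x
  rw [← dotProduct_adjMat_mulVec]
  simp only [Matrix.sub_mulVec, dotProduct_sub, Algebra.algebraMap_eq_smul_one,
    Matrix.smul_mulVec, Matrix.one_mulVec, dotProduct_smul, star_trivial, smul_eq_mul] at h
  have h2 : x ⬝ᵥ x = ∑ u, x u ^ 2 := by simp [dotProduct, sq]
  rw [h2] at h
  linarith

open Classical in
/-- A nonnegative eigenvector for the spectral radius. -/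
lemma exists_nonneg_eigenvector {V : Type*} [Fintype V] [DecidableEq V] [Nonempty V]
    (G : SimpleGraph V) : ∃ x : V → ℝ, (∀ v, 0 ≤ x v) ∧ (∃ v, 0 < x v) ∧
      ∀ u, ∑ v, (if G.Adj u v then x v else 0) = specRad G * x u := by
  have hA := adjMat_isHermitian G
  have hmem : specRad G ∈ spectrum ℝ (adjMat G) := by
    refine Set.Nonempty.csSup_mem ?_ Matrix.finite_real_spectrum
    rw [hA.spectrum_real_eq_range_eigenvalues]
    exact Set.range_nonempty _
  rw [hA.spectrum_real_eq_range_eigenvalues] at hmem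
  obtain ⟨j, hj⟩ := hmem
  set y : V → ℝ := (hA.eigenvectorBasis j).ofLp with hy
  have hyeq : (adjMat G).mulVec y = specRad G • y := by
    rw [← hj]; exact hA.mulVec_eigenvectorBasis j
  have hy0 : ∃ v, y v ≠ 0 := by
    by_contra! hcon
    refine hA.eigenvectorBasis.orthonormal.ne_zero j ?_
    ext v
    exact hcon v
  set x : V → ℝ := fun v => |y v| with hx
  have hxx : x ⬝ᵥ x = y ⬝ᵥ y := by simp [dotProduct, hx]
  have hle : specRad G * (x ⬝ᵥ x) ≤ x ⬝ᵥ (adjMat G).mulVec x := by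
    have h1 : y ⬝ᵥ (adjMat G).mulVec y = specRad G * (x ⬝ᵥ x) := by
      rw [hyeq, dotProduct_smul, hxx, smul_eq_mul]
    rw [← h1, dotProduct_adjMat_mulVec, dotProduct_adjMat_mulVec]
    refine Finset.sum_le_sum fun u _ => Finset.sum_le_sum fun v _ => ?_
    split_ifs
    · rw [hx]; exact (le_abs_self _).trans (abs_mul _ _).le
    · rfl
  have hP := specRad_smul_sub_posSemidef G
  have hz : x ⬝ᵥ (algebraMap ℝ (Matrix V V ℝ) (specRad G) - adjMat G).mulVec x = 0 := by
    refine le_antisymm ?_ (by simpa using hP.dotProduct_mulVec_nonneg x)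
    simp only [Matrix.sub_mulVec, dotProduct_sub, Algebra.algebraMap_eq_smul_one,
      Matrix.smul_mulVec, Matrix.one_mulVec, dotProduct_smul, smul_eq_mul]
    linarith
  have hz' := (hP.dotProduct_mulVec_zero_iff x).1 (by simpa using hz)
  refine ⟨x, fun v => abs_nonneg _, ?_, fun u => ?_⟩
  · obtain ⟨v, hv⟩ := hy0
    exact ⟨v, abs_pos.2 hv⟩
  · have := congrFun hz' u
    simp only [Matrix.sub_mulVec, Algebra.algebraMap_eq_smul_one,
      Matrix.smul_mulVec, Matrix.one_mulVec, Pi.sub_apply, Pi.smul_apply, smul_eq_mul,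
      Pi.zero_apply, adjMat_mulVec] at this
    linarith

lemma sum_sum_eq_erase_add {V : Type*} [Fintype V] [DecidableEq V] (v : V) (M : V → V → ℝ)
    (hM : ∀ u w, M u w = M w u) (hv : M v v = 0) :
    ∑ u, ∑ w, M u w =
      ∑ u ∈ Finset.univ.erase v, ∑ w ∈ Finset.univ.erase v, M u w + 2 * ∑ w, M v w := by
  have h1 : ∀ f : V → ℝ, ∑ u, f u = ∑ u ∈ Finset.univ.erase v, f u + f v := fun f =>
    (Finset.sum_erase_add _ f (Finset.mem_univ v)).symm
  have h2 : ∀ u, ∑ w, M u w = ∑ w ∈ Finset.univ.erase v, M u w + M v u := fun u => by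
    rw [h1, hM u v]
  rw [h1 (fun u => ∑ w, M u w)]
  simp only [h2 _]
  rw [Finset.sum_add_distrib, hv]
  ring

open Classical in
/-- Changing the neighbourhood of one vertex without increasing the spectral radius bounds the
eigenvector weight of the new neighbourhood. -/
lemma sum_neighbors_le_of_specRad_le {V : Type*} [Fintype V] [DecidableEq V]
    {G G' : SimpleGraph V} (hle : specRad G' ≤ specRad G) (hpos : 0 < specRad G)
    {x : V → ℝ} (hx : ∀ v, 0 ≤ x v)
    (heig : ∀ u, ∑ v, (if G.Adj u v then x v else 0) = specRad G * x u) (v : V)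
    (hoff : ∀ u w, u ≠ v → w ≠ v → (G'.Adj u w ↔ G.Adj u w)) :
    ∑ w, (if G'.Adj v w then x w else 0) ≤ specRad G * x v := by
  set S := ∑ w, (if G'.Adj v w then x w else 0) with hS
  set s := S / specRad G with hs
  set y := Function.update x v s with hy
  have hyv : y v = s := by simp [hy]
  have hyne : ∀ u, u ≠ v → y u = x u := fun u hu => by simp [hy, hu]
  have hR := sum_adj_mul_le_specRad G' y
  rw [sum_sum_eq_erase_add v _ (fun u w => by simp [G'.adj_comm u w, mul_comm]) (by simp)] at hR
  have hG : ∑ u, ∑ w, (if G.Adj u w then x u * x w else 0) = specRad G * ∑ u, x u ^ 2 := by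
    rw [Finset.mul_sum]
    refine Finset.sum_congr rfl fun u _ => ?_
    calc _ = x u * ∑ w, (if G.Adj u w then x w else 0) := by
          rw [Finset.mul_sum]; simp
      _ = _ := by rw [heig]; ring
  rw [sum_sum_eq_erase_add v _ (fun u w => by simp [G.adj_comm u w, mul_comm]) (by simp)] at hG
  have e1 : ∑ u ∈ Finset.univ.erase v, ∑ w ∈ Finset.univ.erase v,
      (if G'.Adj u w then y u * y w else 0) = ∑ u ∈ Finset.univ.erase v,
      ∑ w ∈ Finset.univ.erase v, (if G.Adj u w then x u * x w else 0) := by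
    refine Finset.sum_congr rfl fun u hu => Finset.sum_congr rfl fun w hw => ?_
    have hu := Finset.ne_of_mem_erase hu
    have hw := Finset.ne_of_mem_erase hw
    simp only [hoff u w hu hw, hyne u hu, hyne w hw]
  have e2 : ∑ w, (if G'.Adj v w then y v * y w else 0) = s * S := by
    rw [hS, Finset.mul_sum]
    refine Finset.sum_congr rfl fun w _ => ?_
    split_ifs with h
    · rw [hyv, hyne w h.ne']
    · simp
  have e3 : ∑ w, (if G.Adj v w then x v * x w else 0) = specRad G * x v ^ 2 := by
    calc _ = x v * ∑ w, (if G.Adj v w then x w else 0) := by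
          rw [Finset.mul_sum]; simp
      _ = _ := by rw [heig]; ring
  have e4 : ∑ u, y u ^ 2 = ∑ u, x u ^ 2 - x v ^ 2 + s ^ 2 := by
    rw [← Finset.sum_erase_add _ _ (Finset.mem_univ v),
      ← Finset.sum_erase_add _ (fun u => x u ^ 2) (Finset.mem_univ v), hyv]
    rw [Finset.sum_congr rfl fun u hu => by rw [hyne u (Finset.ne_of_mem_erase hu)]]
    ring
  rw [e1, e2] at hR
  rw [e3] at hG
  have hR2 := hR.trans (mul_le_mul_of_nonneg_right hle
    (Finset.sum_nonneg fun u _ => sq_nonneg (y u)))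
  rw [e4] at hR2
  have hSs : S = specRad G * s := by rw [hs]; field_simp
  have key : specRad G * s ^ 2 ≤ specRad G * x v ^ 2 := by
    have : s * S = specRad G * s ^ 2 := by rw [hSs]; ring
    nlinarith
  have h3 : s ^ 2 ≤ x v ^ 2 := le_of_mul_le_mul_left key hpos
  rw [hSs]
  exact mul_le_mul_of_nonneg_left (abs_le_of_sq_le_sq' h3 (hx v)).2 hpos.le

open Classical in
lemma two_mul_eCnt {V : Type*} [Fintype V] (G : SimpleGraph V) :
    2 * (eCnt G : ℝ) = ∑ u, ∑ v, if G.Adj u v then (1 : ℝ) else 0 := by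
  have h := G.sum_degrees_eq_twice_card_edges
  have h2 : eCnt G = G.edgeFinset.card := by
    rw [eCnt, Nat.card_eq_fintype_card, ← edgeFinset_card]
  rw [h2]
  have h3 : (2 : ℝ) * (G.edgeFinset.card : ℝ) = ((∑ v, G.degree v : ℕ) : ℝ) := by
    rw [h]; push_cast; ring
  rw [h3]
  push_cast
  refine Finset.sum_congr rfl fun u _ => ?_
  rw [← card_neighborFinset_eq_degree, neighborFinset_eq_filter, Finset.card_filter]
  push_cast
  rfl

/-- The subgraph of edges joining distinct parts. -/
def crossGraph {V ι : Type*} (G : SimpleGraph V) (p : V → ι) : SimpleGraph V where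
  Adj u v := G.Adj u v ∧ p u ≠ p v
  symm := ⟨fun _ _ h => ⟨h.1.symm, h.2.symm⟩⟩
  loopless := ⟨fun _ h => h.2 rfl⟩

/-- The subgraph of edges inside part `i`. -/
def partGraph {V ι : Type*} (G : SimpleGraph V) (p : V → ι) (i : ι) : SimpleGraph V where
  Adj u v := G.Adj u v ∧ p u = i ∧ p v = i
  symm := ⟨fun _ _ h => ⟨h.1.symm, h.2.2, h.2.1⟩⟩
  loopless := ⟨fun _ h => G.irrefl h.1⟩

lemma crossCnt_eq {n r : ℕ} (G : SimpleGraph (Fin n)) (p : Fin n → Fin r) :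
    crossCnt G p = eCnt (crossGraph G p) := by
  refine Nat.card_congr (Equiv.subtypeEquivRight fun e => ?_)
  induction e using Sym2.ind with
  | _ u v => simp [crossGraph]

lemma inCnt_eq {n r : ℕ} (G : SimpleGraph (Fin n)) (p : Fin n → Fin r) (i : Fin r) :
    inCnt G p i = eCnt (partGraph G p i) := by
  refine Nat.card_congr (Equiv.subtypeEquivRight fun e => ?_)
  induction e using Sym2.ind with
  | _ u v => simp [partGraph, Sym2.diag]

open Classical in
lemma degIn_eq_card {n r : ℕ} (G : SimpleGraph (Fin n)) (p : Fin n → Fin r) (i : Fin r)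
    (v : Fin n) : degIn G p i v = (Finset.univ.filter fun w => G.Adj v w ∧ p w = i).card := by
  rw [degIn, Nat.card_eq_fintype_card, Fintype.card_subtype]

open Classical in
lemma partSize_eq_card {n r : ℕ} (p : Fin n → Fin r) (i : Fin r) :
    partSize p i = (Finset.univ.filter fun w => p w = i).card := by
  rw [partSize, Nat.card_eq_fintype_card, Fintype.card_subtype]

open Classical in
lemma degIn_le_of_max_cut {n r : ℕ} {G : SimpleGraph (Fin n)} {p : Fin n → Fin r}
    (hp : ∀ q : Fin n → Fin r, crossCnt G q ≤ crossCnt G p) (v : Fin n) (j : Fin r) :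
    degIn G p (p v) v ≤ degIn G p j v := by
  by_cases hj : j = p v
  · rw [hj]
  set q := Function.update p v j with hq
  have hqv : q v = j := by simp [hq]
  have hqne : ∀ u, u ≠ v → q u = p u := fun u hu => by simp [hq, hu]
  have h1 : 2 * (crossCnt G q : ℝ) ≤ 2 * (crossCnt G p : ℝ) := by
    exact_mod_cast Nat.mul_le_mul_left 2 (hp q)
  rw [crossCnt_eq, crossCnt_eq, two_mul_eCnt, two_mul_eCnt,
    sum_sum_eq_erase_add v _ (fun u w => by simp [adj_comm _ u w]) (by simp),
    sum_sum_eq_erase_add v _ (fun u w => by simp [adj_comm _ u w]) (by simp)] at h1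
  have e1 : ∑ u ∈ Finset.univ.erase v, ∑ w ∈ Finset.univ.erase v,
      (if (crossGraph G q).Adj u w then (1 : ℝ) else 0) = ∑ u ∈ Finset.univ.erase v,
      ∑ w ∈ Finset.univ.erase v, (if (crossGraph G p).Adj u w then (1 : ℝ) else 0) := by
    refine Finset.sum_congr rfl fun u hu => Finset.sum_congr rfl fun w hw => ?_
    refine if_congr ?_ rfl rfl
    simp only [crossGraph, hqne u (Finset.ne_of_mem_erase hu), hqne w (Finset.ne_of_mem_erase hw)]
  have e2 : ∀ q' : Fin n → Fin r, (∀ u, u ≠ v → q' u = p u) →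
      ∑ w, (if (crossGraph G q').Adj v w then (1 : ℝ) else 0) =
        ∑ w, (if G.Adj v w then (1 : ℝ) else 0) - degIn G p (q' v) v := by
    intro q' hq'
    rw [degIn_eq_card, Finset.card_filter]
    push_cast
    rw [← Finset.sum_sub_distrib]
    refine Finset.sum_congr rfl fun w _ => ?_
    by_cases h : G.Adj v w
    · have := hq' w h.ne'
      by_cases h' : p w = q' v
      · simp [crossGraph, h, this, h']
      · simp [crossGraph, h, this, h', Ne.symm h']
    · simp [crossGraph, h]
  rw [e1, e2 q hqne, e2 p (fun _ _ => rfl), hqv] at h1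
  have : (degIn G p (p v) v : ℝ) ≤ degIn G p j v := by linarith
  exact_mod_cast this

lemma bddAbove_eCnt {W : Type*} (m : ℕ) (F : SimpleGraph W) :
    BddAbove {k | ∃ G : SimpleGraph (Fin m), FFree F G ∧ eCnt G = k} :=
  (Set.finite_range (eCnt (V := Fin m))).bddAbove.mono (by
    rintro k ⟨G, -, rfl⟩
    exact ⟨G, rfl⟩)

lemma Contains.of_comap {W V V' : Type*} {F : SimpleGraph W} {G : SimpleGraph V} {φ : V' → V}
    (hφ : Function.Injective φ) (h : Contains F (G.comap φ)) : Contains F G := by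
  obtain ⟨f, hf⟩ := h
  exact ⟨⟨fun w => φ (f w), fun hab => f.map_rel hab⟩, hφ.comp hf⟩

/-- Every complete `r`-partite graph with parts of size `N` together with `a + 1` edges in one
part contains `F`. -/
def ForcesCopy {W : Type*} (F : SimpleGraph W) (r a N : ℕ) : Prop :=
  ∀ (V : Type) (_ : Fintype V) (G : SimpleGraph V)
    (Y : Fin r → Finset V) (i : Fin r) (E : Finset (Sym2 V)), (∀ j, (Y j).card = N) →
    (∀ i j, i ≠ j → ∀ u ∈ Y i, ∀ v ∈ Y j, G.Adj u v) → E.card = a + 1 →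
    (∀ e ∈ E, e ∈ G.edgeSet) → (∀ e ∈ E, ∀ v ∈ e, v ∈ Y i) → Contains F G

lemma exists_forcesCopy {W : Type*} {r a : ℕ} (hr : 2 ≤ r) {F : SimpleGraph W}
    (h : HypStar r a F) (k : ℕ) : ∃ N ≥ k, ForcesCopy F r a N := by
  obtain ⟨m₀, hm⟩ := h
  refine ⟨max k m₀, le_max_left _ _, fun V _ G Y i E hY hadj hE hEG hEY => ?_⟩
  set N := max k m₀ with hN
  have hNr : m₀ ≤ N * r := (le_max_right _ _).trans (Nat.le_mul_of_pos_right _ (by omega))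
  obtain ⟨hex, -⟩ := hm (N * r) hNr
  let φ : Fin (N * r) → V := fun t => ((Y t.modNat).equivFinOfCardEq (hY _)).symm t.divNat
  have hφY : ∀ t, φ t ∈ Y t.modNat := fun t => Subtype.prop _
  have hmod : ∀ s t : Fin (N * r), s.modNat ≠ t.modNat → G.Adj (φ s) (φ t) := fun s t hst =>
    hadj _ _ hst _ (hφY s) _ (hφY t)
  have hφ : Function.Injective φ := by
    intro s t hst
    by_cases hc : s.modNat = t.modNat
    · apply finProdFinEquiv.symm.injective
      refine Prod.ext ?_ hc
      have : ∀ j j' (hj : j = j') (x x' : Fin N), ((((Y j).equivFinOfCardEq (hY _)).symm x : V) =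
          ((Y j').equivFinOfCardEq (hY _)).symm x') → x = x' := by
        rintro j _ rfl x x' hx
        exact ((Y j).equivFinOfCardEq (hY _)).symm.injective (Subtype.ext hx)
      exact this _ _ hc _ _ hst
    · exact absurd hst (hmod s t hc).ne
  refine Contains.of_comap hφ ?_
  by_contra hfree
  have hle : eCnt (G.comap φ) ≤ eCnt (turanGraph (N * r) r) + a := by
    rw [← hex]
    exact le_csSup (bddAbove_eCnt _ F) ⟨_, hfree, rfl⟩
  have hsub : (turanGraph (N * r) r).edgeSet ∪ Sym2.map φ ⁻¹' (E : Set (Sym2 V)) ⊆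
      (G.comap φ).edgeSet := by
    rintro e (he | he)
    · induction e using Sym2.ind with
      | _ s t =>
        refine hmod s t fun hst => he ?_
        simpa using congrArg Fin.val hst
    · have := hEG _ (by simpa using he)
      induction e using Sym2.ind with
      | _ s t => simpa using this
  have hmem : ∀ t, φ t ∈ Y i → t.modNat = i := by
    intro t ht
    by_contra hne
    exact G.irrefl (hadj _ _ hne _ (hφY t) _ ht)
  have hdisj : Disjoint (turanGraph (N * r) r).edgeSet
      (Sym2.map φ ⁻¹' (E : Set (Sym2 V))) := by
    rw [Set.disjoint_left]
    intro e he he'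
    induction e using Sym2.ind with
    | _ s t =>
      have he' : s(φ s, φ t) ∈ E := by simpa using he'
      have hs := hmem s (hEY _ he' _ (Sym2.mem_mk_left _ _))
      have ht := hmem t (hEY _ he' _ (Sym2.mem_mk_right _ _))
      have he : (s : ℕ) % r ≠ t % r := he
      exact he (by simpa using congrArg Fin.val (hs.trans ht.symm))
  have hrange : (E : Set (Sym2 V)) ⊆ Set.range (Sym2.map φ) := by
    intro e he
    have hpre : ∀ v ∈ Y i, ∃ t, φ t = v := fun v hv => by
      refine ⟨finProdFinEquiv (((Y i).equivFinOfCardEq (hY _)) ⟨v, hv⟩, i), ?_⟩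
      have hsymm : ∀ (t : Fin (N * r)) (q : Fin N × Fin r), finProdFinEquiv.symm t = q →
          φ t = ((Y q.2).equivFinOfCardEq (hY _)).symm q.1 := by
        rintro t _ rfl; rfl
      rw [hsymm _ _ (Equiv.symm_apply_apply _ _)]
      simp
    have hEe := hEY e he
    induction e using Sym2.ind with
    | _ u v =>
      obtain ⟨s, hs⟩ := hpre u (hEe _ (Sym2.mem_mk_left _ _))
      obtain ⟨t, ht⟩ := hpre v (hEe _ (Sym2.mem_mk_right _ _))
      exact ⟨s(s, t), by simp [hs, ht]⟩
  have hcard := Set.ncard_le_ncard hsub (Set.toFinite _)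
  rw [Set.ncard_union_eq hdisj (Set.toFinite _) (Set.toFinite _),
    Set.ncard_preimage_of_injective_subset_range (Sym2.map.injective hφ) hrange,
    Set.ncard_coe_finset, hE] at hcard
  simp only [eCnt, Nat.card_coe_set_eq] at hle
  omega

lemma finite_of_hypStar {W : Type*} {r a : ℕ} (hr : 2 ≤ r) {F : SimpleGraph W}
    (h : HypStar r a F) : Finite W := by
  classical
  obtain ⟨N, hN, hc⟩ := exists_forcesCopy hr h (a + 2)
  let i : Fin r := ⟨0, by omega⟩
  obtain ⟨f, hf⟩ := hc (Fin r × Fin N) inferInstance ⊤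
    (fun j => Finset.univ.image fun t => (j, t)) i
    ((Finset.univ : Finset (Fin (a + 1))).image fun t : Fin (a + 1) =>
      s((i, ⟨0, by omega⟩), (i, ⟨t.val + 1, by omega⟩)))
    (fun j => by
      rw [Finset.card_image_of_injective _ (Prod.mk_right_injective j), Finset.card_univ,
        Fintype.card_fin])
    (by
      intro j j' hjj u hu v hv
      simp only [Finset.mem_image, Finset.mem_univ, true_and] at hu hv
      obtain ⟨t, rfl⟩ := hu
      obtain ⟨t', rfl⟩ := hv
      simp [hjj])
    (by
      rw [Finset.card_image_of_injective, Finset.card_univ, Fintype.card_fin]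
      intro s t hst
      rcases Sym2.eq_iff.1 hst with ⟨-, h'⟩ | ⟨h', -⟩
      · have := congrArg (fun q : Fin r × Fin N => q.2.val) h'
        exact Fin.ext (Nat.succ_injective this)
      · have := congrArg (fun q : Fin r × Fin N => q.2.val) h'
        simp at this)
    (by simp)
    (by
      intro e he v hv
      simp only [Finset.mem_image, Finset.mem_univ, true_and] at he ⊢
      obtain ⟨t, rfl⟩ := he
      rcases Sym2.mem_iff.1 hv with rfl | rfl <;> exact ⟨_, rfl⟩)
  exact Finite.of_injective f hf

open Classical in
/-- The spectral radius of a spectral-extremal graph is at least about that of the Turán graph. -/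
lemma exists_le_specRad {W : Type*} {r a : ℕ} {F : SimpleGraph W}
    (h : HypStar r a F) : ∃ m₀ : ℕ, ∀ n ≥ m₀, ∀ G : SimpleGraph (Fin n), SpecExtremal F G →
      0 < n → (1 - 1 / (r : ℝ)) * n - 1 ≤ specRad G := by
  obtain ⟨m₀, hm⟩ := h
  refine ⟨m₀, fun n hn G hG hn0 => ?_⟩
  obtain ⟨-, hT⟩ := hm n hn
  have hne : {k | ∃ G : SimpleGraph (Fin n), FFree F G ∧ eCnt G = k}.Nonempty :=
    ⟨_, G, hG.1, rfl⟩
  obtain ⟨H, hHF, hHe⟩ := Nat.sSup_mem hne (bddAbove_eCnt n F)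
  obtain ⟨⟨H', hle, ⟨φ⟩⟩, -⟩ := hT H hHF hHe
  refine le_trans ?_ (hG.2 H hHF)
  have hR := sum_adj_mul_le_specRad H (fun _ => 1)
  have hdeg : ∀ u, (1 - 1 / (r : ℝ)) * n - 1 ≤ ∑ v, if H.Adj u v then (1 : ℝ) else 0 := by
    intro u
    have h1 : ∑ v, (if (turanGraph n r).Adj (φ u) v then (1 : ℝ) else 0) ≤
        ∑ v, if H.Adj u v then (1 : ℝ) else 0 := by
      rw [← Equiv.sum_comp φ.toEquiv]
      refine Finset.sum_le_sum fun v _ => ?_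
      by_cases hv : H'.Adj u v
      · simp [hle hv]; split_ifs <;> norm_num
      · have : ¬ (turanGraph n r).Adj (φ u) (φ v) := fun h' => hv (φ.map_adj_iff.1 h')
        have h2 : ¬ (turanGraph n r).Adj (φ u) (φ.toEquiv v) := this
        rw [if_neg h2]; split_ifs <;> norm_num
    refine le_trans ?_ h1
    have h2 : ((Finset.univ.filter fun v : Fin n => (v : ℕ) % r = (φ u : ℕ) % r).card : ℕ) ≤
        n / r + 1 := by
      rw [← Finset.card_range (n / r + 1)]
      refine Finset.card_le_card_of_injOn (fun v => (v : ℕ) / r) (fun v _ => ?_) ?_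
      · simp only [Finset.coe_range, Set.mem_Iio]
        exact Nat.lt_succ_of_le (Nat.div_le_div_right v.2.le)
      · intro v hv w hw hvw
        simp only [Finset.coe_filter, Finset.mem_univ, true_and, Set.mem_ofPred_eq] at hv hw
        apply Fin.ext
        have hvw : (v : ℕ) / r = w / r := hvw
        rw [← Nat.div_add_mod v r, ← Nat.div_add_mod w r, hv, hw, hvw]
    have h3 : ∑ v, (if (turanGraph n r).Adj (φ u) v then (1 : ℝ) else 0) =
        n - ((Finset.univ.filter fun v : Fin n => (v : ℕ) % r = (φ u : ℕ) % r).card : ℝ) := by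
      have : (n : ℝ) = ∑ _v : Fin n, (1 : ℝ) := by simp
      rw [Finset.card_filter, this]
      push_cast
      rw [← Finset.sum_sub_distrib]
      refine Finset.sum_congr rfl fun v _ => ?_
      by_cases hv : (v : ℕ) % r = (φ u : ℕ) % r
      · rw [if_pos hv, if_neg fun h' : (turanGraph n r).Adj (φ u) v => h' hv.symm, sub_self]
      · rw [if_neg hv, if_pos (show (turanGraph n r).Adj (φ u) v from Ne.symm hv), sub_zero]
    rw [h3]
    have h4 : ((n / r : ℕ) : ℝ) ≤ n / r := Nat.cast_div_le
    have h5 : ((Finset.univ.filter fun v : Fin n => (v : ℕ) % r = (φ u : ℕ) % r).card : ℝ) ≤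
        (n / r : ℕ) + 1 := by exact_mod_cast h2
    have h6 : (1 - 1 / (r : ℝ)) * n = n - n / r := by ring
    rw [h6]
    linarith
  have hsum := Finset.sum_le_sum fun u (_ : u ∈ Finset.univ) => hdeg u
  simp only [Finset.sum_const, Finset.card_univ, Fintype.card_fin, nsmul_eq_mul] at hsum
  simp only [mul_one, one_pow, Finset.sum_const, Finset.card_univ, Fintype.card_fin,
    nsmul_eq_mul] at hR
  have hn' : (0 : ℝ) < n := by exact_mod_cast hn0
  have := hsum.trans hR
  rw [mul_comm (specRad H)] at this
  exact le_of_mul_le_mul_left this hn'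

open Classical in
/-- The vertices in the other parts that are not adjacent to `v`. -/
noncomputable def missing {n r : ℕ} (G : SimpleGraph (Fin n)) (p : Fin n → Fin r) (v : Fin n) :
    Finset (Fin n) :=
  Finset.univ.filter fun w => p w ≠ p v ∧ ¬ G.Adj v w

lemma mem_missing {n r : ℕ} {G : SimpleGraph (Fin n)} {p : Fin n → Fin r} {v w : Fin n} :
    w ∈ missing G p v ↔ p w ≠ p v ∧ ¬ G.Adj v w := by
  simp [missing]

lemma sum_cross_mul_le {n r : ℕ} (hr : 0 < r) (p : Fin n → Fin r) (y : Fin n → ℝ) :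
    ∑ z : Fin n × Fin n with p z.1 ≠ p z.2, y z.1 * y z.2 ≤
      (1 - 1 / (r : ℝ)) * (∑ u, y u) ^ 2 := by
  have h1 : (∑ u, y u) ^ 2 = ∑ z : Fin n × Fin n, y z.1 * y z.2 := by
    rw [sq, Finset.sum_mul_sum, Fintype.sum_prod_type]
  have h2 : ∑ z : Fin n × Fin n with p z.1 = p z.2, y z.1 * y z.2 =
      ∑ i, (∑ u with p u = i, y u) ^ 2 := by
    rw [← Finset.sum_fiberwise (Finset.univ.filter fun z : Fin n × Fin n => p z.1 = p z.2)
      (fun z => p z.1)]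
    refine Finset.sum_congr rfl fun i _ => ?_
    rw [sq, Finset.sum_mul_sum, ← Finset.sum_product']
    refine Finset.sum_congr ?_ fun _ _ => rfl
    ext z
    simp only [Finset.mem_filter, Finset.mem_univ, true_and, Finset.mem_product]
    constructor
    · rintro ⟨h, rfl⟩; exact ⟨rfl, h.symm⟩
    · rintro ⟨rfl, h⟩; exact ⟨h.symm, rfl⟩
  have h3 : (∑ u, y u) ^ 2 ≤ r * ∑ i, (∑ u with p u = i, y u) ^ 2 := by
    rw [← Finset.sum_fiberwise Finset.univ p y]
    simpa using sq_sum_le_card_mul_sum_sq (s := (Finset.univ : Finset (Fin r)))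
      (f := fun i => ∑ u with p u = i, y u)
  have h4 := Finset.sum_filter_add_sum_filter_not (Finset.univ : Finset (Fin n × Fin n))
    (fun z => p z.1 = p z.2) (fun z => y z.1 * y z.2)
  rw [h2, ← h1] at h4
  have hr' : (0 : ℝ) < r := by exact_mod_cast hr
  have h5 : (1 / (r : ℝ)) * (∑ u, y u) ^ 2 ≤ ∑ i, (∑ u with p u = i, y u) ^ 2 := by
    rw [one_div, inv_mul_le_iff₀ hr']
    exact h3
  simp only [ne_eq]
  linarith

open Classical in
lemma card_filter_adj_part_le {n r : ℕ} (G : SimpleGraph (Fin n)) (p : Fin n → Fin r) :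
    ((Finset.univ.filter fun z : Fin n × Fin n => G.Adj z.1 z.2 ∧ p z.1 = p z.2).card : ℝ) =
      2 * ∑ i, (inCnt G p i : ℝ) := by
  rw [Finset.mul_sum]
  simp only [inCnt_eq, two_mul_eCnt]
  rw [Finset.card_filter]
  push_cast
  rw [Fintype.sum_prod_type, Finset.sum_comm]
  rw [Finset.sum_comm, Finset.sum_comm (s := (Finset.univ : Finset (Fin r)))]
  refine Finset.sum_congr rfl fun u _ => ?_
  rw [Finset.sum_comm]
  refine Finset.sum_congr rfl fun v _ => ?_
  have : ∀ i, (if (partGraph G p i).Adj u v then (1 : ℝ) else 0) =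
      if p u = i then (if G.Adj u v ∧ p u = p v then 1 else 0) else 0 := by
    intro i
    by_cases hi : p u = i
    · subst hi
      rw [if_pos rfl]
      exact if_congr ⟨fun h => ⟨h.1, h.2.2.symm⟩, fun h => ⟨h.1, rfl, h.2.symm⟩⟩ rfl rfl
    · rw [if_neg hi, if_neg fun h : (partGraph G p i).Adj u v => hi h.2.1]
  simp only [this]
  simp

open Classical in
/-- A graph with few edges inside the parts and large spectral radius is nearly complete
`r`-partite. -/
lemma sum_card_missing_le {n r : ℕ} (hr : 2 ≤ r) {G : SimpleGraph (Fin n)} {p : Fin n → Fin r}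
    {ε : ℝ} (hε : 0 < ε) (hε' : Real.sqrt ε ≤ 1 / 6) (hn : 1 ≤ Real.sqrt ε * n)
    (hin : ∑ i, (inCnt G p i : ℝ) ≤ ε * n ^ 2)
    (hρ : (1 - 1 / (r : ℝ)) * n - 1 ≤ specRad G) {x : Fin n → ℝ} (hx0 : ∃ v, 0 < x v)
    (heig : ∀ u, ∑ v, (if G.Adj u v then x v else 0) = specRad G * x u) :
    ∑ v, ((missing G p v).card : ℝ) ≤ 6 * Real.sqrt ε * n ^ 2 := by
  set t := Real.sqrt ε with ht
  have htpos : 0 < t := Real.sqrt_pos.2 hε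
  have htt : t ^ 2 = ε := Real.sq_sqrt hε.le
  set ρ : ℝ := 1 - 1 / (r : ℝ) with hρdef
  have hr2 : (2 : ℝ) ≤ r := by exact_mod_cast hr
  have hρ2 : 1 / 2 ≤ ρ := by
    have : 1 / (r : ℝ) ≤ 1 / 2 := one_div_le_one_div_of_le (by norm_num) hr2
    rw [hρdef]; linarith
  set s := ∑ u, x u ^ 2 with hs
  have hspos : 0 < s := by
    obtain ⟨v, hv⟩ := hx0
    exact Finset.sum_pos' (fun u _ => sq_nonneg _) ⟨v, Finset.mem_univ v, by positivity⟩
  have hn0 : (0 : ℝ) ≤ n := Nat.cast_nonneg n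
  set P := Finset.univ.filter fun z : Fin n × Fin n => G.Adj z.1 z.2 ∧ p z.1 = p z.2
  set R := Finset.univ.filter fun z : Fin n × Fin n => G.Adj z.1 z.2 ∧ p z.1 ≠ p z.2
  set Z := Finset.univ.filter fun z : Fin n × Fin n => p z.1 ≠ p z.2
  set I := ∑ z ∈ P, x z.1 * x z.2 with hI
  set C := ∑ z ∈ R, x z.1 * x z.2 with hC
  have hQ : I + C = specRad G * s := by
    have h1 : ∑ z : Fin n × Fin n, (if G.Adj z.1 z.2 then x z.1 * x z.2 else 0) =
        specRad G * s := by
      rw [Fintype.sum_prod_type, hs, Finset.mul_sum]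
      refine Finset.sum_congr rfl fun u _ => ?_
      calc _ = x u * ∑ w, (if G.Adj u w then x w else 0) := by
            rw [Finset.mul_sum]; simp
        _ = _ := by rw [heig]; ring
    rw [← h1, ← Finset.sum_filter, ← Finset.sum_filter_add_sum_filter_not _
      (fun z : Fin n × Fin n => p z.1 = p z.2), Finset.filter_filter, Finset.filter_filter]
  have hsq : ∑ z : Fin n × Fin n, (x z.1 * x z.2) ^ 2 = s ^ 2 := by
    rw [sq s, hs, Finset.sum_mul_sum, Fintype.sum_prod_type]
    simp only [mul_pow]
  have hI2 : I ^ 2 ≤ (2 * t * n * s) ^ 2 := by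
    have h1 : I ^ 2 ≤ P.card * ∑ z ∈ P, (x z.1 * x z.2) ^ 2 := sq_sum_le_card_mul_sum_sq
    have h2 : ∑ z ∈ P, (x z.1 * x z.2) ^ 2 ≤ s ^ 2 := by
      rw [← hsq]
      exact Finset.sum_le_univ_sum_of_nonneg fun z => sq_nonneg _
    have h3 : (P.card : ℝ) ≤ 2 * (ε * n ^ 2) := by
      rw [card_filter_adj_part_le]; linarith
    calc I ^ 2 ≤ P.card * s ^ 2 := h1.trans (mul_le_mul_of_nonneg_left h2 (Nat.cast_nonneg _))
      _ ≤ 2 * (ε * n ^ 2) * s ^ 2 := mul_le_mul_of_nonneg_right h3 (sq_nonneg _)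
      _ ≤ 4 * (ε * n ^ 2) * s ^ 2 := by
        have : 0 ≤ ε * (n : ℝ) ^ 2 * s ^ 2 := by positivity
        linarith
      _ = (2 * t * n * s) ^ 2 := by rw [← htt]; ring
  have hI3 : I ≤ 2 * t * n * s := (abs_le_of_sq_le_sq' hI2 (by positivity)).2
  have hClow : (ρ - 3 * t) * n * s ≤ C := by
    have h1 : (ρ - t) * n ≤ specRad G := by nlinarith
    have h2 := mul_le_mul_of_nonneg_right h1 hspos.le
    linarith
  have hRsub : R ⊆ Z := fun z hz => by
    simp only [R, Z, Finset.mem_filter] at hz ⊢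
    exact ⟨hz.1, hz.2.2⟩
  have hC2 : C ^ 2 ≤ R.card * (ρ * s ^ 2) := by
    refine sq_sum_le_card_mul_sum_sq.trans
      (mul_le_mul_of_nonneg_left ?_ (Nat.cast_nonneg _))
    refine le_trans (Finset.sum_le_sum_of_subset_of_nonneg hRsub fun z _ _ => sq_nonneg _) ?_
    have := sum_cross_mul_le (by omega) p (fun u => x u ^ 2)
    simpa only [mul_pow] using this
  have hZ : (Z.card : ℝ) ≤ ρ * n ^ 2 := by
    have := sum_cross_mul_le (by omega) p (fun _ => 1)
    simpa [Z, ρ] using this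
  have hM : ∑ v, ((missing G p v).card : ℝ) + R.card = Z.card := by
    have h1 : ∑ v, ((missing G p v).card : ℝ) = (Z.filter fun z => ¬ G.Adj z.1 z.2).card := by
      rw [Finset.filter_filter, Finset.card_filter]
      push_cast
      rw [Fintype.sum_prod_type]
      refine Finset.sum_congr rfl fun v _ => ?_
      rw [missing, Finset.card_filter]
      push_cast
      exact Finset.sum_congr rfl fun w _ => if_congr (by rw [ne_comm]) rfl rfl
    have h2 : R = Z.filter fun z => G.Adj z.1 z.2 := by
      rw [Finset.filter_filter]
      exact Finset.filter_congr fun z _ => and_comm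
    rw [h1, h2, add_comm]
    exact_mod_cast Finset.card_filter_add_card_filter_not (s := Z) fun z => G.Adj z.1 z.2
  set M := ∑ v, ((missing G p v).card : ℝ)
  have h3 : ((ρ - 3 * t) * n * s) ^ 2 ≤ C ^ 2 := by
    refine pow_le_pow_left₀ ?_ hClow 2
    have : 0 ≤ ρ - 3 * t := by linarith
    positivity
  have h4 : ((ρ - 3 * t) * n) ^ 2 * s ^ 2 ≤ (R.card * ρ) * s ^ 2 := by nlinarith
  have h5 : ((ρ - 3 * t) * n) ^ 2 ≤ R.card * ρ := le_of_mul_le_mul_right h4 (by positivity)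
  have h6 : (R.card : ℝ) ≤ ρ * n ^ 2 - M := by linarith
  have h7 : ρ * M ≤ ρ * (6 * t * n ^ 2) := by
    have : R.card * ρ ≤ (ρ * n ^ 2 - M) * ρ := mul_le_mul_of_nonneg_right h6 (by linarith)
    have h8 : 0 ≤ t ^ 2 * (n : ℝ) ^ 2 := by positivity
    nlinarith
  exact le_of_mul_le_mul_left h7 (by linarith)

/-- Greedy construction of a complete multipartite subgraph. -/
lemma exists_complete_multipartite {n r : ℕ} {G : SimpleGraph (Fin n)} {p : Fin n → Fin r}
    {X : Fin r → Finset (Fin n)} {D N : ℕ} (hX : ∀ j, ∀ u ∈ X j, p u = j)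
    (hD : ∀ j, ∀ u ∈ X j, (missing G p u).card ≤ D)
    (hcard : ∀ j, N + r * N * D ≤ (X j).card) (s : Finset (Fin r)) :
    ∃ Y : Fin r → Finset (Fin n), (∀ j ∈ s, Y j ⊆ X j ∧ (Y j).card = N) ∧
      ∀ i ∈ s, ∀ j ∈ s, i ≠ j → ∀ u ∈ Y i, ∀ v ∈ Y j, G.Adj u v := by
  classical
  induction s using Finset.induction_on with
  | empty => exact ⟨fun _ => ∅, by simp, by simp⟩
  | insert k s hk ih =>
    obtain ⟨Y, hY, hadj⟩ := ih
    set B := (s.biUnion Y).biUnion (missing G p) with hB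
    have hBcard : B.card ≤ r * N * D := by
      calc B.card ≤ (s.biUnion Y).card * D := by
            refine Finset.card_biUnion_le_card_mul _ _ _ fun u hu => ?_
            obtain ⟨j, hj, hu⟩ := Finset.mem_biUnion.1 hu
            exact hD j u ((hY j hj).1 hu)
        _ ≤ (s.card * N) * D := Nat.mul_le_mul_right _
            (Finset.card_biUnion_le_card_mul _ _ _ fun j hj => (hY j hj).2.le)
        _ ≤ _ := Nat.mul_le_mul_right _ (Nat.mul_le_mul_right _ (by
            simpa using Finset.card_le_univ s))
    have hlarge : N ≤ (X k \ B).card := by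
      have := Finset.le_card_sdiff B (X k)
      have := hcard k
      omega
    obtain ⟨Yk, hYk, hYkc⟩ := Finset.exists_subset_card_eq hlarge
    have hnew : ∀ j ∈ s, ∀ u ∈ Y j, ∀ v ∈ Yk, G.Adj u v := by
      intro j hj u hu v hv
      have hv' := Finset.mem_sdiff.1 (hYk hv)
      by_contra hnadj
      refine hv'.2 (Finset.mem_biUnion.2 ⟨u, Finset.mem_biUnion.2 ⟨j, hj, hu⟩, ?_⟩)
      refine mem_missing.2 ⟨?_, hnadj⟩
      rw [hX k v hv'.1, hX j u ((hY j hj).1 hu)]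
      rintro rfl
      exact hk hj
    have hne : ∀ j ∈ s, j ≠ k := fun j hj h => hk (h ▸ hj)
    refine ⟨Function.update Y k Yk, fun j hj => ?_, fun i hi j hj hij u hu v hv => ?_⟩
    · rcases Finset.mem_insert.1 hj with rfl | hj
      · simpa using ⟨hYk.trans Finset.sdiff_subset, hYkc⟩
      · simpa [hne j hj] using hY j hj
    · rcases Finset.mem_insert.1 hi with rfl | hi' <;>
        rcases Finset.mem_insert.1 hj with rfl | hj'
      · exact absurd rfl hij
      · simp only [Function.update_self, Function.update_of_ne (hne j hj')] at hu hv
        exact (hnew j hj' v hv u hu).symm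
      · simp only [Function.update_self, Function.update_of_ne (hne i hi')] at hu hv
        exact hnew i hi' u hu v hv
      · simp only [Function.update_of_ne (hne i hi'), Function.update_of_ne (hne j hj')] at hu hv
        exact hadj i hi' j hj' hij u hu v hv

lemma contains_of_seed {W : Type*} {F : SimpleGraph W} {n r a N D : ℕ}
    (hF : ForcesCopy F r a N) {G : SimpleGraph (Fin n)} {p : Fin n → Fin r}
    {X : Fin r → Finset (Fin n)} (hX : ∀ j, ∀ u ∈ X j, p u = j)
    (hD : ∀ j, ∀ u ∈ X j, (missing G p u).card ≤ D)
    (hcard : ∀ j, N + r * N * D ≤ (X j).card) {i : Fin r} {U : Finset (Fin n)}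
    (hU : U.card ≤ N) (hUX : ∀ j ≠ i, ∀ u ∈ U, ∀ w ∈ X j, G.Adj u w)
    (hdisj : Disjoint U (X i)) {E : Finset (Sym2 (Fin n))} (hE : E.card = a + 1)
    (hEG : ∀ e ∈ E, e ∈ G.edgeSet) (hEU : ∀ e ∈ E, ∀ v ∈ e, v ∈ U) : Contains F G := by
  classical
  obtain ⟨Y, hY, hadj⟩ := exists_complete_multipartite hX hD hcard Finset.univ
  have hY : ∀ j, Y j ⊆ X j ∧ (Y j).card = N := fun j => hY j (Finset.mem_univ j)
  have hadj : ∀ i j, i ≠ j → ∀ u ∈ Y i, ∀ v ∈ Y j, G.Adj u v := fun i j =>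
    hadj i (Finset.mem_univ i) j (Finset.mem_univ j)
  obtain ⟨Y', hY', hYc⟩ := Finset.exists_subset_card_eq
    (show N - U.card ≤ (Y i).card by rw [(hY i).2]; omega)
  have hnew : ∀ j ≠ i, ∀ u ∈ U ∪ Y', ∀ v ∈ Y j, G.Adj u v := by
    intro j hj u hu v hv
    rcases Finset.mem_union.1 hu with hu | hu
    · exact hUX j hj u hu v ((hY j).1 hv)
    · exact hadj i j hj.symm u (hY' hu) v hv
  refine hF (Fin n) inferInstance G (Function.update Y i (U ∪ Y')) i E (fun j => ?_)
    (fun j k hjk u hu v hv => ?_) hE hEG (fun e he v hv => ?_)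
  · by_cases hj : j = i
    · subst hj
      rw [Function.update_self, Finset.card_union_of_disjoint
        (hdisj.mono_right (hY'.trans (hY _).1)), hYc]
      omega
    · rw [Function.update_of_ne hj]
      exact (hY j).2
  · by_cases hj : j = i
    · subst hj
      rw [Function.update_self] at hu
      rw [Function.update_of_ne hjk.symm] at hv
      exact hnew k hjk.symm u hu v hv
    · rw [Function.update_of_ne hj] at hu
      by_cases hk : k = i
      · subst hk
        rw [Function.update_self] at hv
        exact (hnew j hj v hv u hu).symm
      · rw [Function.update_of_ne hk] at hv
        exact hadj j k hjk u hu v hv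
  · rw [Function.update_self]
    exact Finset.mem_union_left _ (hEU e he v hv)

open Classical in
lemma degIn_lt_of_ffree {W : Type*} {F : SimpleGraph W} {n r a N D g : ℕ}
    (hF : ForcesCopy F r a N) {G : SimpleGraph (Fin n)} (hG : FFree F G) {p : Fin n → Fin r}
    (hp : ∀ q : Fin n → Fin r, crossCnt G q ≤ crossCnt G p) (hN : a + 2 ≤ N)
    {B : Finset (Fin n)} (hB : ∀ v, v ∉ B → (missing G p v).card ≤ D) (hBc : B.card ≤ D)
    (hpart : ∀ j, N + r * N * D + D + (a + 2) ≤ partSize p j)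
    (hg : N + r * N * D + D + (a + 1) * D + (a + 1) ≤ g) (v : Fin n) :
    degIn G p (p v) v < g := by
  by_contra! hcon
  set i := p v with hi
  set Nb : Fin r → Finset (Fin n) := fun j => Finset.univ.filter fun w => G.Adj v w ∧ p w = j
  have hNb : ∀ j, g ≤ (Nb j).card := fun j => by
    rw [← degIn_eq_card]
    exact hcon.trans (degIn_le_of_max_cut hp v j)
  obtain ⟨L, hL, hLc⟩ := Finset.exists_subset_card_eq (show a + 1 ≤ (Nb i \ B).card by
    have := Finset.le_card_sdiff B (Nb i)
    have := hNb i
    omega)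
  have hLp : ∀ w ∈ L, G.Adj v w ∧ p w = i ∧ w ∉ B := fun w hw => by
    have := hL hw
    simp only [Nb, Finset.mem_sdiff, Finset.mem_filter, Finset.mem_univ, true_and] at this
    exact ⟨this.1.1, this.1.2, this.2⟩
  have hUc : (insert v L).card ≤ a + 2 := (Finset.card_insert_le _ _).trans (by omega)
  set X : Fin r → Finset (Fin n) := fun j =>
    if j = i then (Finset.univ.filter fun w => p w = i) \ (B ∪ insert v L)
    else Nb j \ (B ∪ L.biUnion (missing G p)) with hX
  have hXi : X i = (Finset.univ.filter fun w => p w = i) \ (B ∪ insert v L) := by simp [hX]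
  have hXj : ∀ j ≠ i, X j = Nb j \ (B ∪ L.biUnion (missing G p)) := fun j hj => by simp [hX, hj]
  have hXmem : ∀ j, ∀ u ∈ X j, p u = j ∧ u ∉ B := by
    intro j u hu
    by_cases hj : j = i
    · subst hj
      rw [hXi] at hu
      simp only [Finset.mem_sdiff, Finset.mem_filter, Finset.mem_univ, true_and,
        Finset.mem_union, not_or] at hu
      exact ⟨hu.1, hu.2.1⟩
    · rw [hXj j hj] at hu
      simp only [Nb, Finset.mem_sdiff, Finset.mem_filter, Finset.mem_univ, true_and,
        Finset.mem_union, not_or] at hu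
      exact ⟨hu.1.2, hu.2.1⟩
  refine hG (contains_of_seed hF (X := X) (D := D) (i := i) (U := insert v L)
    (E := L.image fun w => s(v, w)) (fun j u hu => (hXmem j u hu).1)
    (fun j u hu => hB u (hXmem j u hu).2) (fun j => ?_) (hUc.trans hN) (fun j hj u hu w hw => ?_)
    ?_ ?_ ?_ ?_)
  · by_cases hj : j = i
    · subst hj
      rw [hXi]
      have h1 := Finset.le_card_sdiff (B ∪ insert v L) (Finset.univ.filter fun w => p w = i)
      have h2 := Finset.card_union_le B (insert v L)
      have h3 := hpart i
      rw [partSize_eq_card] at h3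
      omega
    · rw [hXj j hj]
      have h1 := Finset.le_card_sdiff (B ∪ L.biUnion (missing G p)) (Nb j)
      have h2 := Finset.card_union_le B (L.biUnion (missing G p))
      have h3 : (L.biUnion (missing G p)).card ≤ L.card * D :=
        Finset.card_biUnion_le_card_mul _ _ _ fun w hw => hB w (hLp w hw).2.2
      rw [hLc] at h3
      have := hNb j
      omega
  · rw [hXj j hj] at hw
    simp only [Nb, Finset.mem_sdiff, Finset.mem_filter, Finset.mem_univ, true_and,
      Finset.mem_union, not_or] at hw
    rcases Finset.mem_insert.1 hu with rfl | hu
    · exact hw.1.1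
    · by_contra hna
      refine hw.2.2 (Finset.mem_biUnion.2 ⟨u, hu, mem_missing.2 ⟨?_, hna⟩⟩)
      rw [hw.1.2, (hLp u hu).2.1]
      exact hj
  · rw [hXi]
    exact Finset.disjoint_sdiff.mono_left Finset.subset_union_right
  · rw [Finset.card_image_of_injective, hLc]
    exact fun w w' hw => Sym2.congr_right.1 hw
  · intro e he
    obtain ⟨w, hw, rfl⟩ := Finset.mem_image.1 he
    exact (hLp w hw).1
  · intro e he u hu
    obtain ⟨w, hw, rfl⟩ := Finset.mem_image.1 he
    rcases Sym2.mem_iff.1 hu with rfl | rfl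
    · exact Finset.mem_insert_self _ _
    · exact Finset.mem_insert_of_mem hw

lemma card_biUnion_toFinset_le {V : Type*} [DecidableEq V] (E : Finset (Sym2 V)) :
    (E.biUnion Sym2.toFinset).card ≤ 2 * E.card := by
  rw [mul_comm]
  refine Finset.card_biUnion_le_card_mul _ _ _ fun e _ => ?_
  rw [Sym2.card_toFinset]
  split_ifs <;> omega

open Classical in
lemma eCnt_partGraph_le {W : Type*} {F : SimpleGraph W} {n r a N D : ℕ}
    (hF : ForcesCopy F r a N) {G : SimpleGraph (Fin n)} (hG : FFree F G) {p : Fin n → Fin r}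
    (hN : 2 * (a + 1) ≤ N) (hD : ∀ v, (missing G p v).card ≤ D)
    (hpart : ∀ j, N + r * N * D + 2 * (a + 1) * D + 2 * (a + 1) ≤ partSize p j) (i : Fin r) :
    eCnt (partGraph G p i) ≤ a := by
  by_contra! hcon
  rw [eCnt, Nat.card_eq_fintype_card, ← edgeFinset_card] at hcon
  obtain ⟨E, hE, hEc⟩ := Finset.exists_subset_card_eq (Nat.succ_le_of_lt hcon)
  set U := E.biUnion Sym2.toFinset with hUdef
  have hUc : U.card ≤ 2 * (a + 1) := (card_biUnion_toFinset_le E).trans (by omega)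
  have hEmem : ∀ e ∈ E, e ∈ (partGraph G p i).edgeSet := fun e he => mem_edgeFinset.1 (hE he)
  have hUp : ∀ u ∈ U, p u = i := by
    intro u hu
    obtain ⟨e, he, hu⟩ := Finset.mem_biUnion.1 hu
    have hu := Sym2.mem_toFinset.1 hu
    have he := hEmem e he
    induction e using Sym2.ind with
    | _ v w => rcases Sym2.mem_iff.1 hu with rfl | rfl; exacts [he.2.1, he.2.2]
  set X : Fin r → Finset (Fin n) := fun j =>
    (Finset.univ.filter fun w => p w = j) \ (if j = i then U else U.biUnion (missing G p)) with hX
  refine hG (contains_of_seed hF (X := X) (D := D) (i := i) (U := U) (E := E)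
    (fun j u hu => ?_) (fun j u _ => hD u) (fun j => ?_) (hUc.trans hN) (fun j hj u hu w hw => ?_)
    ?_ hEc ?_ ?_)
  · simpa using (Finset.mem_sdiff.1 hu).1
  · have h1 := Finset.le_card_sdiff (if j = i then U else U.biUnion (missing G p))
      (Finset.univ.filter fun w => p w = j)
    have h2 : (if j = i then U else U.biUnion (missing G p)).card ≤
        2 * (a + 1) * D + 2 * (a + 1) := by
      split_ifs
      · omega
      · refine (Finset.card_biUnion_le_card_mul _ _ D fun w _ => hD w).trans ?_
        exact (Nat.mul_le_mul_right D hUc).trans (Nat.le_add_right _ _)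
    have h3 := hpart j
    rw [partSize_eq_card] at h3
    change _ ≤ Finset.card (_ \ _)
    omega
  · have hw : p w = j ∧ w ∉ U.biUnion (missing G p) := by simpa [hX, hj] using hw
    by_contra hna
    refine hw.2 (Finset.mem_biUnion.2 ⟨u, hu, mem_missing.2 ⟨?_, hna⟩⟩)
    rw [hw.1, hUp u hu]
    exact hj
  · simp only [hX, if_true]
    exact Finset.disjoint_sdiff
  · intro e he
    have he := hEmem e he
    induction e using Sym2.ind with
    | _ v w => exact he.1
  · intro e he v hv
    exact Finset.mem_biUnion.2 ⟨e, he, Sym2.mem_toFinset.2 hv⟩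

open Classical in
lemma card_nonisolated_le {n r : ℕ} (G : SimpleGraph (Fin n)) (p : Fin n → Fin r) (i : Fin r) :
    Nat.card {u : Fin n // p u = i ∧ 1 ≤ degIn G p i u} ≤ 2 * eCnt (partGraph G p i) := by
  rw [eCnt, Nat.card_eq_fintype_card, Nat.card_eq_fintype_card, ← edgeFinset_card,
    Fintype.card_subtype]
  refine le_trans (Finset.card_le_card fun u hu => ?_)
    (card_biUnion_toFinset_le (partGraph G p i).edgeFinset)
  simp only [Finset.mem_filter, Finset.mem_univ, true_and, degIn_eq_card] at hu
  obtain ⟨w, hw⟩ := Finset.card_pos.1 hu.2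
  simp only [Finset.mem_filter, Finset.mem_univ, true_and] at hw
  refine Finset.mem_biUnion.2 ⟨s(u, w), mem_edgeFinset.2 ?_, by simp⟩
  exact ⟨hw.1, hu.1, hw.2⟩

/-- `G` with the neighbourhood of `v` replaced by `T`. -/
def replaceNeighbors {V : Type*} (G : SimpleGraph V) (v : V) (T : Finset V) (hv : v ∉ T) :
    SimpleGraph V where
  Adj u w := (u ≠ v ∧ w ≠ v ∧ G.Adj u w) ∨ (u = v ∧ w ∈ T) ∨ (w = v ∧ u ∈ T)
  symm := ⟨fun u w h => by
    rcases h with h | h | h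
    · exact Or.inl ⟨h.2.1, h.1, h.2.2.symm⟩
    · exact Or.inr (Or.inr h)
    · exact Or.inr (Or.inl h)⟩
  loopless := ⟨fun u h => by
    rcases h with h | ⟨rfl, h⟩ | ⟨rfl, h⟩
    · exact G.irrefl h.2.2
    · exact hv h
    · exact hv h⟩

open Classical in
lemma FFree.replaceNeighbors {W V : Type*} [Finite W] {F : SimpleGraph W}
    {G : SimpleGraph V} (hG : FFree F G) {v : V} {T : Finset V} (hv : v ∉ T) {X : Finset V}
    {D : ℕ} (hT : ∀ b ∈ T, (X.filter fun u => ¬ G.Adj b u).card ≤ D)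
    (hX : Nat.card W + Nat.card W * D < X.card) : FFree F (replaceNeighbors G v T hv) := by
  have := Fintype.ofFinite W
  rw [Nat.card_eq_fintype_card] at hX
  rintro ⟨f, hf⟩
  set I : Finset V := Finset.univ.image f with hI
  have hIc : I.card ≤ Fintype.card W := Finset.card_image_le
  have hBc : ((I.filter (· ∈ T)).biUnion fun b => X.filter fun u => ¬ G.Adj b u).card ≤
      Fintype.card W * D :=
    (Finset.card_biUnion_le_card_mul _ _ D fun b hb => hT b (Finset.mem_filter.1 hb).2).trans
      (Nat.mul_le_mul_right _ ((Finset.card_filter_le _ _).trans hIc))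
  obtain ⟨v', hv'X, hv'⟩ := Finset.exists_mem_notMem_of_card_lt_card (lt_of_le_of_lt
    ((Finset.card_union_le I _).trans (add_le_add hIc hBc)) hX)
  rw [Finset.mem_union, not_or] at hv'
  have hv'I : ∀ w, f w ≠ v' := fun w hw => hv'.1 (hw ▸ Finset.mem_image_of_mem _ (Finset.mem_univ w))
  have hadj : ∀ w, f w ∈ T → G.Adj (f w) v' := by
    intro w hw
    by_contra hna
    exact hv'.2 (Finset.mem_biUnion.2 ⟨f w, Finset.mem_filter.2
      ⟨Finset.mem_image_of_mem _ (Finset.mem_univ w), hw⟩, Finset.mem_filter.2 ⟨hv'X, hna⟩⟩)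
  refine hG ⟨⟨fun w => if f w = v then v' else f w, fun {s t} hst => ?_⟩, fun s t hst => ?_⟩
  · have hne : f s ≠ f t := fun h => hst.ne (hf h)
    rcases f.map_rel hst with h | ⟨h1, h2⟩ | ⟨h1, h2⟩
    · simp only [h.1, h.2.1, if_false]
      exact h.2.2
    · have : f t ≠ v := fun h => hne (h1.trans h.symm)
      simp only [h1, this, if_true, if_false]
      exact (hadj t h2).symm
    · have : f s ≠ v := fun h => hne (h.trans h1.symm)
      simp only [h1, this, if_true, if_false]
      exact hadj s h2
  · change (if f s = v then v' else f s) = (if f t = v then v' else f t) at hst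
    split_ifs at hst with h1 h2 h2
    · exact hf (h1.trans h2.symm)
    · exact absurd hst.symm (hv'I t)
    · exact absurd hst (hv'I s)
    · exact hf hst

open Classical in
lemma SpecExtremal.sum_le {W : Type*} [Finite W] {F : SimpleGraph W} {n : ℕ}
    {G : SimpleGraph (Fin n)} (hG : SpecExtremal F G) (hpos : 0 < specRad G)
    {x : Fin n → ℝ} (hx : ∀ v, 0 ≤ x v)
    (heig : ∀ u, ∑ v, (if G.Adj u v then x v else 0) = specRad G * x u)
    {v : Fin n} {T : Finset (Fin n)} (hv : v ∉ T) {X : Finset (Fin n)}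
    {D : ℕ} (hT : ∀ b ∈ T, (X.filter fun u => ¬ G.Adj b u).card ≤ D)
    (hX : Nat.card W + Nat.card W * D < X.card) : ∑ w ∈ T, x w ≤ specRad G * x v := by
  have hle := hG.2 _ (hG.1.replaceNeighbors hv hT hX)
  refine le_of_eq_of_le ?_ (sum_neighbors_le_of_specRad_le hle hpos hx heig v
    fun u w hu hw => by simp [_root_.replaceNeighbors, hu, hw])
  rw [← Finset.sum_filter]
  refine Finset.sum_congr ?_ fun _ _ => rfl
  ext w
  simp only [Finset.mem_filter, Finset.mem_univ, true_and, _root_.replaceNeighbors, ne_eq,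
    not_true_eq_false, false_and, false_or]
  constructor
  · exact Or.inl
  · rintro (h | ⟨rfl, h⟩) <;> exact h

open Classical in
/-- Every vertex of a spectral-extremal graph has positive eigenvector weight and is adjacent to
almost all vertices of the other parts. -/
lemma SpecExtremal.pos_and_card_missing_le {W : Type*} [Finite W] {F : SimpleGraph W}
    {n r D g : ℕ} {G : SimpleGraph (Fin n)} (hG : SpecExtremal F G) (hpos : 0 < specRad G)
    {x : Fin n → ℝ} (hx : ∀ v, 0 ≤ x v) (hx0 : ∃ v, 0 < x v)
    (heig : ∀ u, ∑ v, (if G.Adj u v then x v else 0) = specRad G * x u)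
    {p : Fin n → Fin r} (hr : 1 ≤ r)
    {B : Finset (Fin n)} (hB : ∀ v, v ∉ B → (missing G p v).card ≤ D) (hBc : B.card ≤ D)
    (hg : ∀ v, degIn G p (p v) v ≤ g) (hgρ : 2 * ((g : ℝ) + D) ≤ specRad G)
    (hpart : ∀ j, Nat.card W + Nat.card W * D < partSize p j)
    (hpart' : ∀ j, (n : ℝ) ≤ 4 * r * ((partSize p j : ℝ) - D)) (v : Fin n) :
    0 < x v ∧ (missing G p v).card ≤ 8 * r * (g + D) + D := by
  have : Nonempty (Fin n) := ⟨v⟩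
  obtain ⟨v₀, hmax⟩ := Finite.exists_max x
  set m := x v₀ with hm
  have hmpos : 0 < m := by
    obtain ⟨u, hu⟩ := hx0
    exact hu.trans_le (hmax u)
  set S : Fin r → Finset (Fin n) := fun i => Finset.univ.filter fun w => p w ≠ i ∧ w ∉ B with hS
  have hlow : ∀ u, ∑ w ∈ S (p u), x w ≤ specRad G * x u := by
    intro u
    refine hG.sum_le hpos hx heig (X := Finset.univ.filter fun w => p w = p u) (D := D)
      (by simp [hS]) (fun b hb => ?_) (by rw [← partSize_eq_card]; exact hpart _)
    simp only [hS, Finset.mem_filter, Finset.mem_univ, true_and] at hb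
    refine (Finset.card_le_card fun w hw => ?_).trans (hB b hb.2)
    simp only [Finset.mem_filter, Finset.mem_univ, true_and] at hw
    refine mem_missing.2 ⟨?_, hw.2⟩
    rw [hw.1]
    exact hb.1.symm
  have hup : ∀ u, specRad G * x u ≤ ∑ w ∈ (S (p u)).filter (G.Adj u), x w + (g + D) * m := by
    intro u
    have h1 : ∑ w, (if G.Adj u w then x w else 0) ≤
        ∑ w, ((if w ∈ (S (p u)).filter (G.Adj u) then x w else 0) +
          ((if G.Adj u w ∧ p w = p u then m else 0) + if w ∈ B then m else 0)) := by
      refine Finset.sum_le_sum fun w _ => ?_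
      have h2 := hx w
      have h3 := hmax w
      by_cases ha : G.Adj u w
      · by_cases hb : w ∈ B
        · have : 0 ≤ (if w ∈ (S (p u)).filter (G.Adj u) then x w else 0) := by
            split_ifs <;> linarith
          have : 0 ≤ (if G.Adj u w ∧ p w = p u then m else 0) := by split_ifs <;> linarith
          simp only [ha, hb, if_true] at *
          linarith
        · by_cases hc : p w = p u <;> simp [hS, ha, hb, hc, h3]
      · have : 0 ≤ (if w ∈ B then m else 0) := by split_ifs <;> linarith
        simp [ha, this]
    rw [heig, Finset.sum_add_distrib, Finset.sum_add_distrib, Finset.sum_ite_mem,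
      Finset.sum_ite_mem, Finset.univ_inter, Finset.univ_inter, ← Finset.sum_filter,
      Finset.sum_const, Finset.sum_const, ← degIn_eq_card, nsmul_eq_mul, nsmul_eq_mul] at h1
    have h2 : (degIn G p (p u) u : ℝ) ≤ g := by exact_mod_cast hg u
    have h3 : (B.card : ℝ) ≤ D := by exact_mod_cast hBc
    have h4 := mul_le_mul_of_nonneg_right h2 hmpos.le
    have h5 := mul_le_mul_of_nonneg_right h3 hmpos.le
    linarith
  have hrho : specRad G ≤ n := by
    have h1 : specRad G * m ≤ n * m := by
      rw [hm, ← heig v₀]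
      refine (Finset.sum_le_card_nsmul _ _ m fun w _ => ?_).trans_eq (by simp [m])
      split_ifs
      · exact hmax w
      · exact hmpos.le
    exact le_of_mul_le_mul_right h1 hmpos
  have hr' : (1 : ℝ) ≤ r := by exact_mod_cast hr
  have hhalf : ∀ u, p u = p v₀ → m / 2 ≤ x u := by
    intro u hu
    have h1 := hlow u
    have h2 := hup v₀
    have h3 : ∑ w ∈ (S (p v₀)).filter (G.Adj v₀), x w ≤ ∑ w ∈ S (p v₀), x w :=
      Finset.sum_le_sum_of_subset_of_nonneg (Finset.filter_subset _ _) fun w _ _ => hx w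
    rw [hu] at h1
    have h4 := mul_le_mul_of_nonneg_right hgρ hmpos.le
    have h5 : specRad G * (m / 2) ≤ specRad G * x u := by linarith
    exact le_of_mul_le_mul_left h5 hpos
  have hall : ∀ u, m ≤ 8 * r * x u := by
    intro u
    by_cases hu : p u = p v₀
    · have h1 := hhalf u hu
      nlinarith [hx u]
    · have hsub : (Finset.univ.filter fun w => p w = p v₀) \ B ⊆ S (p u) := by
        intro w hw
        simp only [Finset.mem_sdiff, Finset.mem_filter, Finset.mem_univ, true_and] at hw
        simp only [hS, Finset.mem_filter, Finset.mem_univ, true_and]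
        exact ⟨by rw [hw.1]; exact Ne.symm hu, hw.2⟩
      have h1 : ((partSize p (p v₀) : ℝ) - D) * (m / 2) ≤ ∑ w ∈ S (p u), x w := by
        calc ((partSize p (p v₀) : ℝ) - D) * (m / 2)
            ≤ (((Finset.univ.filter fun w => p w = p v₀) \ B).card : ℝ) * (m / 2) := by
              refine mul_le_mul_of_nonneg_right ?_ (by positivity)
              have h2 := Finset.le_card_sdiff B (Finset.univ.filter fun w => p w = p v₀)
              rw [partSize_eq_card, sub_le_iff_le_add]
              exact_mod_cast (by omega)
          _ ≤ ∑ w ∈ (Finset.univ.filter fun w => p w = p v₀) \ B, x w := by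
              rw [← nsmul_eq_mul]
              refine Finset.card_nsmul_le_sum _ _ _ fun w hw => hhalf w ?_
              simpa using (Finset.mem_sdiff.1 hw).1
          _ ≤ _ := Finset.sum_le_sum_of_subset_of_nonneg hsub fun w _ _ => hx w
      have h2 := h1.trans (hlow u)
      have h3 : specRad G * x u ≤ n * x u := mul_le_mul_of_nonneg_right hrho (hx u)
      have h4 := mul_le_mul_of_nonneg_right (hpart' (p v₀)) (show 0 ≤ m by linarith)
      have h5 : (n : ℝ) * m ≤ n * (8 * r * x u) := by
        have h6 := mul_le_mul_of_nonneg_left (h2.trans h3) (show (0 : ℝ) ≤ 8 * r by linarith)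
        nlinarith
      exact le_of_mul_le_mul_left h5 (hpos.trans_le hrho)
  refine ⟨by nlinarith [hall v], ?_⟩
  set A := (S (p v)).filter fun w => ¬ G.Adj v w with hA
  have hsub : missing G p v ⊆ A ∪ B := by
    intro w hw
    have hw := mem_missing.1 hw
    by_cases hb : w ∈ B
    · exact Finset.mem_union_right _ hb
    · refine Finset.mem_union_left _ ?_
      simp [hA, hS, hb, hw.1, hw.2]
  have hAc : A.card ≤ 8 * r * (g + D) := by
    have h1 : ∑ w ∈ A, x w ≤ (g + D) * m := by
      have h2 := Finset.sum_filter_add_sum_filter_not (S (p v)) (G.Adj v) x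
      have h3 := (hlow v).trans (hup v)
      linarith
    have h2 : (A.card : ℝ) * m ≤ ∑ w ∈ A, 8 * r * x w := by
      rw [← nsmul_eq_mul]
      exact Finset.card_nsmul_le_sum _ _ _ fun w _ => hall w
    rw [← Finset.mul_sum] at h2
    have h3 := mul_le_mul_of_nonneg_left h1 (show (0 : ℝ) ≤ 8 * r by linarith)
    have h4 : (A.card : ℝ) * m ≤ (8 * r * (g + D)) * m := by linarith
    have h5 := le_of_mul_le_mul_right h4 hmpos
    exact_mod_cast h5
  calc _ ≤ (A ∪ B).card := Finset.card_le_card hsub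
    _ ≤ A.card + B.card := Finset.card_union_le _ _
    _ ≤ _ := add_le_add hAc hBc

open Classical in
/-- A vertex without neighbours in its own part is adjacent to all vertices of the other parts. -/
lemma SpecExtremal.adj_of_degIn_eq_zero {W : Type*} [Finite W] {F : SimpleGraph W}
    {n r D : ℕ} {G : SimpleGraph (Fin n)} (hG : SpecExtremal F G) (hpos : 0 < specRad G)
    {x : Fin n → ℝ} (hx : ∀ v, 0 < x v)
    (heig : ∀ u, ∑ v, (if G.Adj u v then x v else 0) = specRad G * x u)
    {p : Fin n → Fin r} (hD : ∀ v, (missing G p v).card ≤ D)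
    (hpart : ∀ j, Nat.card W + Nat.card W * D < partSize p j) {u w : Fin n}
    (hu : degIn G p (p u) u = 0) (hw : p w ≠ p u) : G.Adj u w := by
  by_contra hna
  have hout : ∀ b, G.Adj u b → p b ≠ p u := by
    intro b hb hpb
    rw [degIn_eq_card, Finset.card_eq_zero] at hu
    have : b ∈ (∅ : Finset (Fin n)) := by
      rw [← hu]; simp [hb, hpb]
    simp at this
  have hnot : w ∉ Finset.univ.filter (G.Adj u) := by simpa using hna
  have hT : ∀ b ∈ insert w (Finset.univ.filter (G.Adj u)), p b ≠ p u := by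
    intro b hb
    rcases Finset.mem_insert.1 hb with rfl | hb
    · exact hw
    · exact hout b (by simpa using hb)
  have h1 := hG.sum_le hpos (fun v => (hx v).le) heig (v := u)
    (T := insert w (Finset.univ.filter (G.Adj u))) (X := Finset.univ.filter fun w => p w = p u)
    (D := D) (fun h => hT u h rfl) (fun b hb => ?_)
    (by rw [← partSize_eq_card]; exact hpart _)
  · rw [Finset.sum_insert hnot, ← heig u, ← Finset.sum_filter] at h1
    linarith [hx w]
  · refine (Finset.card_le_card fun y hy => ?_).trans (hD b)
    simp only [Finset.mem_filter, Finset.mem_univ, true_and] at hy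
    refine mem_missing.2 ⟨?_, hy.2⟩
    rw [hy.1]
    exact (hT b hb).symm

open Classical in
lemma card_filter_missing_le {n r : ℕ} {G : SimpleGraph (Fin n)} {p : Fin n → Fin r} {η : ℝ}
    (hη : 0 < η) (hn : 0 < n) (hM : ∑ v, ((missing G p v).card : ℝ) ≤ η ^ 2 * n ^ 2) :
    (Finset.univ.filter fun v => ⌊η * n⌋₊ < (missing G p v).card).card ≤ ⌊η * n⌋₊ := by
  set B := Finset.univ.filter fun v => ⌊η * n⌋₊ < (missing G p v).card with hB
  have hpos : 0 < η * n := mul_pos hη (by exact_mod_cast hn)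
  have h1 : (B.card : ℝ) * (η * n) ≤ ∑ v ∈ B, ((missing G p v).card : ℝ) := by
    rw [← nsmul_eq_mul]
    refine Finset.card_nsmul_le_sum _ _ _ fun v hv => ?_
    have hv : ⌊η * n⌋₊ + 1 ≤ (missing G p v).card := by simpa [hB] using hv
    exact (Nat.lt_floor_add_one _).le.trans (by exact_mod_cast hv)
  have h2 : ∑ v ∈ B, ((missing G p v).card : ℝ) ≤ ∑ v, ((missing G p v).card : ℝ) :=
    Finset.sum_le_univ_sum_of_nonneg fun v => Nat.cast_nonneg _
  refine Nat.le_floor (le_of_mul_le_mul_right ?_ hpos)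
  nlinarith

lemma sqrt_le_of_lt_theta {r ℓ : ℕ} {θ ε τ : ℝ} (hr : 1 ≤ r) (hτpos : 0 < τ)
    (hℓ : ⌈1 / τ ^ 2⌉₊ + 1 ≤ ℓ) (hθ : 0 < θ) (hθℓ : θ < 1 / (100 * r ^ 5 * ℓ))
    (hε : 0 < ε) (hεθ : 2 * ε < θ ^ 3) : Real.sqrt ε ≤ τ := by
  have hℓ1 : 1 / τ ^ 2 + 1 ≤ ℓ := by
    have h1 := Nat.le_ceil (1 / τ ^ 2)
    have h2 : ((⌈1 / τ ^ 2⌉₊ + 1 : ℕ) : ℝ) ≤ ℓ := by exact_mod_cast hℓ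
    push_cast at h2
    linarith
  have hτ2 : 0 < 1 / τ ^ 2 := by positivity
  have hℓpos : (0 : ℝ) < ℓ := by linarith
  have h1 : θ ≤ 1 / ℓ := by
    refine hθℓ.le.trans (one_div_le_one_div_of_le hℓpos ?_)
    have : (1 : ℝ) ≤ (r : ℝ) ^ 5 := one_le_pow₀ (by exact_mod_cast hr)
    nlinarith
  have h2 : (1 : ℝ) / ℓ ≤ τ ^ 2 := by
    rw [div_le_iff₀ hℓpos]
    have : 1 = τ ^ 2 * (1 / τ ^ 2) := by field_simp
    have h3 : 0 < τ ^ 2 := by positivity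
    nlinarith
  have h3 : θ ≤ 1 := h1.trans (by rw [div_le_one hℓpos]; linarith)
  have h4 : θ ^ 3 ≤ θ := by
    have : θ ^ 2 ≤ 1 := pow_le_one₀ hθ.le h3
    nlinarith
  rw [Real.sqrt_le_left hτpos.le]
  linarith

set_option maxHeartbeats 1000000 in
theorem stmt_12 {W : Type*} (r a : ℕ) (hr : 2 ≤ r) (F : SimpleGraph W) (h : HypStar r a F) :
    ∃ ℓ₀ : ℕ, ∀ ℓ ≥ ℓ₀, ∀ θ ε : ℝ, 0 < θ → 0 < ε →
      θ < 1 / (100 * r ^ 5 * ℓ) → 2 * ε < θ ^ 3 →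
      ∃ n₀ : ℕ, ∀ n ≥ n₀, ∀ G : SimpleGraph (Fin n), SpecExtremal F G →
        ∀ p : Fin n → Fin r, GoodPartition r G ε p →
          ∀ i : Fin r,
            Nat.card {u : Fin n // p u = i ∧ 1 ≤ degIn G p i u} ≤ 2 * a ∧
            ∀ u : Fin n, p u = i → degIn G p i u = 0 →
              ∀ w : Fin n, p w ≠ i → G.Adj u w := by
  classical
  have hfin : Finite W := finite_of_hypStar hr h
  obtain ⟨N, hN, hF⟩ := exists_forcesCopy hr h (2 * (a + 1))
  obtain ⟨m₀, hm₀⟩ := exists_le_specRad h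
  obtain ⟨H, hH⟩ : ∃ H, H = N + r * N + 2 * a + 4 + Nat.card W := ⟨_, rfl⟩
  obtain ⟨d₁, hd₁⟩ : ∃ d₁, d₁ = 8 * r * (r * N + a + 3) + 1 := ⟨_, rfl⟩
  obtain ⟨d₀, hd₀⟩ : ∃ d₀, d₀ = 8 * r * (N + a + 1) := ⟨_, rfl⟩
  have hr2 : (2 : ℝ) ≤ r := by exact_mod_cast hr
  have hHd : (1 : ℝ) ≤ H * d₁ := by
    exact_mod_cast Nat.mul_pos (by omega : 0 < H) (by omega : 0 < d₁)
  obtain ⟨η, hη⟩ : ∃ η : ℝ, η = 1 / (8 * r * (H * d₁)) := ⟨_, rfl⟩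
  have hηpos : 0 < η := by rw [hη]; positivity
  have hηmul : 8 * r * (H * d₁) * η = 1 := by
    rw [hη]
    exact mul_one_div_cancel (by positivity)
  have hη1 : η ≤ 1 := by
    rw [hη, div_le_one (by positivity)]
    nlinarith
  obtain ⟨τ, hτ⟩ : ∃ τ : ℝ, τ = η ^ 2 / (6 * r) := ⟨_, rfl⟩
  have hτpos : 0 < τ := by rw [hτ]; positivity
  have hτη : 6 * r * τ = η ^ 2 := by rw [hτ]; field_simp
  have hτr : 6 * τ * r ≤ 1 := by nlinarith
  refine ⟨⌈1 / τ ^ 2⌉₊ + 1, fun ℓ hℓ θ ε hθ hε hθℓ hεθ => ?_⟩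
  have hετ : Real.sqrt ε ≤ τ :=
    sqrt_le_of_lt_theta (by omega) hτpos hℓ hθ hθℓ hε hεθ
  set t := Real.sqrt ε with ht
  have htpos : 0 < t := Real.sqrt_pos.2 hε
  refine ⟨m₀ + 8 * r * (H * (d₀ + 1)) + ⌈1 / t⌉₊ + 4, fun n hn G hG p hp => ?_⟩
  obtain ⟨hcut, hin, hsize⟩ := hp
  have hn0 : 0 < n := by omega
  have hnR : (0 : ℝ) < n := by exact_mod_cast hn0
  have hn4 : (4 : ℝ) ≤ n := by exact_mod_cast (by omega : 4 ≤ n)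
  have hnK : 8 * r * (H * (d₀ + 1 : ℝ)) ≤ n := by
    exact_mod_cast (by omega : 8 * r * (H * (d₀ + 1)) ≤ n)
  have hnt : 1 ≤ t * n := by
    have h1 : 1 / t ≤ n := (Nat.le_ceil _).trans (by exact_mod_cast (by omega : ⌈1 / t⌉₊ ≤ n))
    rw [div_le_iff₀ htpos] at h1
    linarith
  have hρ := hm₀ n (by omega) G hG hn0
  have hrinv : 1 / (r : ℝ) ≤ 1 / 2 := one_div_le_one_div_of_le (by norm_num) hr2
  have hρ8 : (n : ℝ) / 8 ≤ specRad G := by nlinarith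
  have hpos : 0 < specRad G := by linarith
  have : Nonempty (Fin n) := ⟨⟨0, hn0⟩⟩
  obtain ⟨x, hx, hx0, heig⟩ := exists_nonneg_eigenvector G
  have hM := sum_card_missing_le hr hε (by nlinarith) hnt hin hρ hx0 heig
  have hBc := card_filter_missing_le hηpos hn0 (hM.trans (by
    refine mul_le_mul_of_nonneg_right ?_ (sq_nonneg _)
    nlinarith))
  have hB : ∀ v, v ∉ (Finset.univ.filter fun v => ⌊η * n⌋₊ < (missing G p v).card) →
      (missing G p v).card ≤ ⌊η * n⌋₊ := fun v hv => by simpa using hv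
  generalize (Finset.univ.filter fun v => ⌊η * n⌋₊ < (missing G p v).card) = B at hB hBc
  have hDle : (⌊η * n⌋₊ : ℝ) ≤ η * n := Nat.floor_le (by positivity)
  generalize ⌊η * n⌋₊ = D at hB hBc hDle
  obtain ⟨g, hg⟩ : ∃ g, g = N + r * N * D + D + (a + 1) * D + (a + 1) := ⟨_, rfl⟩
  obtain ⟨D', hD'⟩ : ∃ D', D' = 8 * r * (g + D) + D := ⟨_, rfl⟩
  have hD'eq : D' = d₁ * D + d₀ := by rw [hD', hg, hd₁, hd₀]; ring
  have hkey : 4 * r * (H * (D' + 1 : ℝ)) ≤ n := by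
    have h1 : 8 * r * (H * d₁ * (D : ℝ)) ≤ n := by
      calc 8 * r * (H * d₁ * (D : ℝ)) ≤ 8 * r * (H * d₁ * (η * n)) := by gcongr
        _ = n := by linear_combination (n : ℝ) * hηmul
    have h2 : (D' : ℝ) = d₁ * D + d₀ := by exact_mod_cast hD'eq
    have h3 : 4 * r * (H * (D' + 1 : ℝ)) =
        (8 * r * (H * d₁ * (D : ℝ)) + 8 * r * (H * (d₀ + 1 : ℝ))) / 2 := by rw [h2]; ring
    linarith
  have hps : ∀ j, (n : ℝ) ≤ 2 * r * partSize p j := by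
    intro j
    have h1 := (hsize j).1.le
    have h2 : (1 / (r : ℝ) - 3 * t) * n * (2 * r) ≤ partSize p j * (2 * r) :=
      mul_le_mul_of_nonneg_right h1 (by linarith)
    have h3 : (1 / (r : ℝ) - 3 * t) * n * (2 * r) = (2 - 6 * t * r) * n := by field_simp; ring
    have h4 : 6 * t * r ≤ 1 := by nlinarith
    nlinarith
  have hpart : ∀ j, H * (D' + 1) < partSize p j := by
    intro j
    have h1 := hps j
    have h2 : (r : ℝ) * (2 * (H * (D' + 1 : ℝ))) ≤ r * partSize p j := by nlinarith
    have h3 : 2 * (H * (D' + 1 : ℝ)) ≤ partSize p j := le_of_mul_le_mul_left h2 (by linarith)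
    have h4 : 2 * (H * (D' + 1)) ≤ partSize p j := by exact_mod_cast h3
    have h5 : 0 < H * (D' + 1) := Nat.mul_pos (by omega) (by omega)
    omega
  have hDD' : D ≤ D' := by rw [hD']; exact Nat.le_add_left _ _
  have hHexp : H * (D' + 1) =
      N * D' + r * N * D' + 2 * a * D' + 4 * D' + Nat.card W * D' + (N + r * N + 2 * a + 4 + Nat.card W) := by
    rw [hH]; ring
  have hrND : r * N * D ≤ r * N * D' := Nat.mul_le_mul_left _ hDD'
  have hfD : Nat.card W * D ≤ Nat.card W * D' := Nat.mul_le_mul_left _ hDD'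
  have hdeg : ∀ v, degIn G p (p v) v ≤ g := fun v =>
    (degIn_lt_of_ffree hF hG.1 hcut (by omega) hB hBc
      (fun j => by have := hpart j; omega) hg.ge v).le
  have hmain := hG.pos_and_card_missing_le hpos hx hx0 heig (by omega : 1 ≤ r) hB hBc hdeg
    (by
      have h1 : 2 * (g + D) ≤ D' := by
        have : 2 * (g + D) ≤ 8 * r * (g + D) := Nat.mul_le_mul_right _ (by omega)
        omega
      have h2 : 2 * ((g : ℝ) + D) ≤ D' := by exact_mod_cast h1
      have h3 : D' ≤ H * (D' + 1) := by omega
      have h4 : (D' : ℝ) ≤ H * (D' + 1 : ℝ) := by exact_mod_cast h3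
      nlinarith)
    (fun j => by have := hpart j; omega)
    (fun j => by
      have h3 : D ≤ H * (D' + 1) := by omega
      have h4 : (D : ℝ) ≤ H * (D' + 1 : ℝ) := by exact_mod_cast h3
      have := hps j
      nlinarith)
  have hmiss : ∀ v, (missing G p v).card ≤ D' := fun v => (hmain v).2.trans hD'.ge
  refine fun i => ⟨?_, ?_⟩
  · refine (card_nonisolated_le G p i).trans (Nat.mul_le_mul_left 2 ?_)
    refine eCnt_partGraph_le hF hG.1 hN hmiss (fun j => ?_) i
    have h1 := hpart j
    have h2 : 2 * (a + 1) * D' = 2 * a * D' + 2 * D' := by ring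
    omega
  · rintro u rfl hu w hw
    exact hG.adj_of_degIn_eq_zero hpos (fun v => (hmain v).1) heig hmiss
      (fun j => by have := hpart j; omega) hu hw
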